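/- Every monotone outerplanar DAG admits a linear extension whose maximum twist size is at most 4. -/

import Mathlib

/-- The vertex set of a directed edge set. -/
def verts (E : Finset (ℕ × ℕ)) : Finset ℕ := E.image Prod.fst ∪ E.image Prod.snd

/-- Two directed edges cross with respect to a vertex order `f`
(the order places vertex `v` at position `f v`). -/
def Crosses (f : ℕ → ℕ) (e e' : ℕ × ℕ) : Prop :=
  (f e.1 < f e'.1 ∧ f e'.1 < f e.2 ∧ f e.2 < f e'.2) ∨
  (f e'.1 < f e.1 ∧ f e.1 < f e'.2 ∧ f e'.2 < f e.2)

/-- `f` is (an injective position function representing) a linear extension of `E`. -/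
def LinExt (E : Finset (ℕ × ℕ)) (f : ℕ → ℕ) : Prop :=
  Function.Injective f ∧ ∀ e ∈ E, f e.1 < f e.2

/-- The edges `(s i, t i)` form a `k`-twist under `f`:
`s 0 < … < s (k-1) < t 0 < … < t (k-1)`. -/
def IsTwist (E : Finset (ℕ × ℕ)) (f : ℕ → ℕ) (k : ℕ) (s t : Fin k → ℕ) : Prop :=
  (∀ i, (s i, t i) ∈ E) ∧ StrictMono (f ∘ s) ∧ StrictMono (f ∘ t) ∧
    ∀ i j, f (s i) < f (t j)

/-- The maximum twist size of `E` under `f` is at most `k`. -/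
def TwistLE (E : Finset (ℕ × ℕ)) (f : ℕ → ℕ) (k : ℕ) : Prop :=
  ∀ m, ∀ s t : Fin m → ℕ, IsTwist E f m s t → m ≤ k

/-- `c` assigns edges to stacks: edges in the same stack never cross. -/
def ValidStacks (E : Finset (ℕ × ℕ)) (f : ℕ → ℕ) (c : ℕ × ℕ → ℕ) : Prop :=
  ∀ e ∈ E, ∀ e' ∈ E, c e = c e' → ¬ Crosses f e e'

/-- `E` admits a `k`-stack layout: a linear extension together with a
partition of the edges into `k` stacks of pairwise non-crossing edges. -/
def HasStackLayout (E : Finset (ℕ × ℕ)) (k : ℕ) : Prop :=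
  ∃ f c, LinExt E f ∧ (∀ e ∈ E, c e < k) ∧ ValidStacks E f c

/-- Construction of monotone outerplanar DAGs from a base edge by stellating a
not-yet-stellated outerface edge `(u,v)` with a fresh vertex `x` using only
the monotone operations: add `(u,x),(v,x)` or `(x,u),(x,v)`. -/
inductive MonBuild : Finset (ℕ × ℕ) → Finset (ℕ × ℕ) → Prop
  | base (s t : ℕ) (h : s ≠ t) : MonBuild {(s, t)} {(s, t)}
  | monoSink (E A : Finset (ℕ × ℕ)) (u v x : ℕ) (hE : MonBuild E A)
      (hA : (u, v) ∈ A) (hx : x ∉ verts E) :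
      MonBuild (insert (u, x) (insert (v, x) E))
        (insert (u, x) (insert (v, x) (A.erase (u, v))))
  | monoSource (E A : Finset (ℕ × ℕ)) (u v x : ℕ) (hE : MonBuild E A)
      (hA : (u, v) ∈ A) (hx : x ∉ verts E) :
      MonBuild (insert (x, u) (insert (x, v) E))
        (insert (x, u) (insert (x, v) (A.erase (u, v))))

/-- A monotone outerplanar DAG. -/
def IsMonotoneODAG (E : Finset (ℕ × ℕ)) : Prop := ∃ A, MonBuild E A

/-- The maximal twist shapes. A layout of a monotone outerplanar DAG with base edge `(s, t)` splits
the vertices into six consecutive blocks `0, …, 5`, where `1` is `{s}` and `4` is `{t}`; an edge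
from block `a` to block `b` is coded by `6 * a + b`, and a twist by the list of its codes. -/
def maxShapes : List (List ℕ) := [
   [1, 2, 2],
   [2, 2, 8],
   [2, 2, 10],
   [2, 2, 11],
   [4, 23, 23],
   [10, 23, 23],
   [22, 23, 23],
   [23, 23, 29],
   [0, 0, 0, 0],
   [0, 0, 0, 1],
   [0, 0, 0, 2],
   [0, 0, 0, 4],
   [0, 0, 0, 5],
   [0, 0, 1, 2],
   [0, 0, 1, 4],
   [0, 0, 1, 5],
   [0, 0, 2, 2],
   [0, 0, 2, 4],
   [0, 0, 2, 5],
   [2, 2, 14, 14],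
   [2, 8, 14, 14],
   [2, 14, 14, 14],
   [5, 23, 35, 35],
   [5, 29, 35, 35],
   [5, 35, 35, 35],
   [8, 14, 14, 14],
   [11, 23, 35, 35],
   [11, 29, 35, 35],
   [11, 35, 35, 35],
   [14, 14, 14, 14],
   [21, 21, 21, 21],
   [21, 21, 21, 22],
   [21, 21, 21, 23],
   [21, 21, 22, 23],
   [21, 21, 23, 23],
   [23, 23, 35, 35],
   [23, 29, 35, 35],
   [23, 35, 35, 35],
   [29, 35, 35, 35],
   [35, 35, 35, 35]]

/-- The list of edge codes is the shape of an admissible twist. -/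
def admissible (l : List ℕ) : Bool := maxShapes.any l.isSublist

/-- `place k i a` is the position, among the eleven blocks of the combined layout, of block `a` of
the first (`i = 1`) or second (`i = 2`) part, and of the base edge (`i = 0`). The stellating vertex
is a sink for `k = true` and a source for `k = false`. -/
def place (k : Bool) (i a : ℕ) : ℕ :=
  ((bif k then [[0, 1, 0, 0, 4, 0], [0, 1, 2, 6, 8, 10], [3, 4, 5, 7, 8, 9]]
    else [[0, 6, 0, 0, 9, 0], [1, 2, 3, 5, 6, 7], [0, 2, 4, 8, 9, 10]]).getD i []).getD a 0

/-- The block of the merged layout that contains one of the eleven blocks. -/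
def mergeBlock (k : Bool) (j : ℕ) : ℕ :=
  (bif k then [0, 1, 2, 3, 4, 5, 5, 5, 5, 5, 5] else [0, 0, 0, 0, 0, 0, 1, 2, 3, 4, 5]).getD j 0

/-- The blocks among the eleven ones that consist of a single vertex. -/
def isSingle (k : Bool) (j : ℕ) : Bool :=
  bif k then j == 1 || j == 4 || j == 8 else j == 2 || j == 6 || j == 9

/-- A vertex in block `i` can precede a different vertex in block `j`, for two of the eleven
blocks. -/
def precedes (k : Bool) (i j : ℕ) : Bool := Nat.blt i j || (i == j && !isSingle k i)

/-- An edge of type `(i, a, b)` (part `i`, from block `a` to block `b`) can precede another one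
in a twist. -/
def compatible (k : Bool) (p q : ℕ × ℕ × ℕ) : Bool :=
  precedes k (place k p.1 p.2.1) (place k q.1 q.2.1) &&
  precedes k (place k p.1 p.2.2) (place k q.1 q.2.2) &&
  precedes k (place k q.1 q.2.1) (place k p.1 p.2.2)

/-- The shape of the edges of part `i`. -/
def partShape (i : ℕ) (c : List (ℕ × ℕ × ℕ)) : List ℕ :=
  (c.filter (fun p => p.1 == i)).map (fun p => 6 * p.2.1 + p.2.2)

/-- The shape in the merged layout. -/
def mergedShape (k : Bool) (c : List (ℕ × ℕ × ℕ)) : List ℕ :=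
  c.map (fun p => 6 * mergeBlock k (place k p.1 p.2.1) + mergeBlock k (place k p.1 p.2.2))

/-- The types of edges: the base edge, and those of the two parts. -/
def edgeTypes : List (ℕ × ℕ × ℕ) :=
  (0, 1, 4) :: [1, 2].flatMap fun i =>
    ((List.range 36).filter fun n => admissible [n]).map fun n => (i, n / 6, n % 6)

/-- An edge of type `p` can be prepended to a twist with edge types `c` whose two parts have
admissible shapes. -/
def canExtend (k : Bool) (p : ℕ × ℕ × ℕ) (c : List (ℕ × ℕ × ℕ)) : Bool :=
  c.all (compatible k p) && (admissible (partShape 1 (p :: c)) && admissible (partShape 2 (p :: c)))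

/-- All extensions of `c` to a twist with admissible parts have less than `n` additional edges
and an admissible merged shape. -/
def extensionsAdmissible (k : Bool) : ℕ → List (ℕ × ℕ × ℕ) → Bool
  | 0, _ => false
  | n + 1, c => admissible (mergedShape k c) &&
      edgeTypes.all fun p => !canExtend k p c || extensionsAdmissible k n (p :: c)

theorem extensionsAdmissible_nil (k : Bool) : extensionsAdmissible k 5 [] = true := by
  cases k <;> decide +kernel

/-- A list of edges, sorted by position, that forms a twist under `f`. -/
def TwistList (f : ℕ → ℕ) (l : List (ℕ × ℕ)) : Prop :=
  l.Pairwise fun e e' => f e.1 < f e'.1 ∧ f e.2 < f e'.2 ∧ f e'.1 < f e.2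

/-- `f` is a vertex order of `E` with blocks `b` all of whose twists have admissible shapes. -/
structure IsBlockLayout (s t : ℕ) (E : Finset (ℕ × ℕ)) (f b : ℕ → ℕ) : Prop where
  lt_of_mem : ∀ e ∈ E, f e.1 < f e.2
  inj : ∀ u ∈ verts E, ∀ v ∈ verts E, f u = f v → u = v
  block_lt : ∀ u ∈ verts E, b u < 6
  lt_of_block_lt : ∀ u ∈ verts E, ∀ v ∈ verts E, b u < b v → f u < f v
  left_mem : s ∈ verts E
  right_mem : t ∈ verts E
  left : ∀ u ∈ verts E, b u = 1 ↔ u = s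
  right : ∀ u ∈ verts E, b u = 4 ↔ u = t
  admissible_of_twist : ∀ l : List (ℕ × ℕ), (∀ e ∈ l, e ∈ E) → TwistList f l →
    admissible (l.map fun e => 6 * b e.1 + b e.2) = true

theorem mem_verts {E : Finset (ℕ × ℕ)} {u : ℕ} : u ∈ verts E ↔ ∃ e ∈ E, u = e.1 ∨ u = e.2 := by
  simp only [verts, Finset.mem_union, Finset.mem_image]
  grind

theorem fst_mem_verts {E : Finset (ℕ × ℕ)} {e : ℕ × ℕ} (h : e ∈ E) : e.1 ∈ verts E :=
  mem_verts.2 ⟨e, h, Or.inl rfl⟩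

theorem snd_mem_verts {E : Finset (ℕ × ℕ)} {e : ℕ × ℕ} (h : e ∈ E) : e.2 ∈ verts E :=
  mem_verts.2 ⟨e, h, Or.inr rfl⟩

theorem verts_singleton (s t : ℕ) : verts {(s, t)} = {s, t} := by
  ext u; simp [verts]

theorem verts_insert (e : ℕ × ℕ) (E : Finset (ℕ × ℕ)) :
    verts (insert e E) = insert e.1 (insert e.2 (verts E)) := by
  ext u; simp [verts]; grind

theorem verts_union (E F : Finset (ℕ × ℕ)) : verts (E ∪ F) = verts E ∪ verts F := by
  ext u; simp [verts, Finset.image_union]; grind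

theorem isBlockLayout_singleton {s t : ℕ} (h : s ≠ t) :
    IsBlockLayout s t {(s, t)} (fun v => if v = s then 0 else 1)
      (fun v => if v = s then 1 else 4) where
  lt_of_mem := by simp [h.symm]
  inj := by simp [verts_singleton]; grind
  block_lt := by simp [verts_singleton]; grind
  lt_of_block_lt := by simp [verts_singleton]; grind
  left_mem := by simp [verts_singleton]
  right_mem := by simp [verts_singleton]
  left := by simp [verts_singleton]
  right := by simp [verts_singleton, h, h.symm]
  admissible_of_twist := by
    intro l hl ht
    match l, hl, ht with
    | [], _, _ => rfl
    | [e], hl, _ =>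
      obtain rfl : e = (s, t) := by simpa using hl
      simp [h.symm]
      decide
    | e :: e' :: l, hl, ht =>
      obtain rfl : e = (s, t) := by simpa using hl e
      obtain rfl : e' = (s, t) := by simpa using hl e'
      simp [TwistList] at ht

theorem place_lt_place (k : Bool) (i : ℕ) (hi : i = 1 ∨ i = 2) :
    ∀ b < 6, ∀ a < b, place k i a < place k i b := by
  rcases hi with rfl | rfl <;> cases k <;> decide

theorem place_lt (k : Bool) (i : ℕ) (hi : i < 3) : ∀ a < 6, place k i a < 11 := by
  interval_cases i <;> cases k <;> decide

theorem eq_of_place_eq (k : Bool) : ∀ a < 6, ∀ b < 6, place k 1 a = place k 2 b →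
    a = (bif k then 4 else 1) ∧ b = (bif k then 4 else 1) := by
  cases k <;> decide

theorem eq_one_or_four_of_isSingle_place (k : Bool) (i : ℕ) (hi : i = 1 ∨ i = 2) :
    ∀ a < 6, isSingle k (place k i a) = true → a = 1 ∨ a = 4 := by
  rcases hi with rfl | rfl <;> cases k <;> decide

theorem lt_of_mergeBlock_lt (k : Bool) :
    ∀ i < 11, ∀ j < 11, mergeBlock k i < mergeBlock k j → i < j := by
  cases k <;> decide

theorem mergeBlock_lt (k : Bool) : ∀ i < 11, mergeBlock k i < 6 := by
  cases k <;> decide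

theorem mergeBlock_eq_one (k : Bool) : ∀ i < 11, mergeBlock k i = 1 ↔ i = place k 0 1 := by
  cases k <;> decide

theorem mergeBlock_eq_four (k : Bool) : ∀ i < 11, mergeBlock k i = 4 ↔ i = place k 0 4 := by
  cases k <;> decide

theorem mem_edgeTypes {i a b : ℕ} (hi : i = 1 ∨ i = 2) (ha : a < 6) (hb : b < 6)
    (h : admissible [6 * a + b] = true) : (i, a, b) ∈ edgeTypes := by
  refine List.mem_cons_of_mem _ (List.mem_flatMap.2 ⟨i, by simpa using hi, ?_⟩)
  refine List.mem_map.2 ⟨6 * a + b, List.mem_filter.2 ⟨List.mem_range.2 (by omega), h⟩, ?_⟩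
  simp only [Prod.mk.injEq, true_and]
  omega

theorem length_le_four_of_admissible {l : List ℕ} (h : admissible l = true) : l.length ≤ 4 := by
  obtain ⟨m, hm, hl⟩ := List.any_eq_true.1 h
  have hm4 : ∀ m ∈ maxShapes, m.length ≤ 4 := by decide
  exact (List.isSublist_iff_sublist.1 hl).length_le.trans (hm4 m hm)

/-- Every twist type obtained from an extensible one has an admissible merged shape. -/
theorem admissible_of_closed (k : Bool) {α : Type*} (P : List α → Prop) (c : α → ℕ × ℕ × ℕ)
    (htail : ∀ a l, P (a :: l) → P l)
    (hext : ∀ a l, P (a :: l) → c a ∈ edgeTypes ∧ canExtend k (c a) (l.map c) = true)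
    (l : List α) (hl : P l) : admissible (mergedShape k (l.map c)) = true := by
  have key : ∃ n, extensionsAdmissible k n (l.map c) = true := by
    induction l with
    | nil => exact ⟨5, extensionsAdmissible_nil k⟩
    | cons a l ih =>
      obtain ⟨n, hn⟩ := ih (htail a l hl)
      obtain ⟨hmem, hcan⟩ := hext a l hl
      cases n with
      | zero => simp [extensionsAdmissible] at hn
      | succ n =>
        simp only [extensionsAdmissible, Bool.and_eq_true, List.all_eq_true] at hn
        have := hn.2 _ hmem
        rw [hcan] at this
        exact ⟨n, by simpa using this⟩
  obtain ⟨n, hn⟩ := key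
  cases n with
  | zero => simp [extensionsAdmissible] at hn
  | succ n =>
    simp only [extensionsAdmissible, Bool.and_eq_true] at hn
    exact hn.1

theorem IsBlockLayout.eq_of_isSingle_place {k : Bool} {s t i u v : ℕ} {E : Finset (ℕ × ℕ)}
    {f b : ℕ → ℕ} (h : IsBlockLayout s t E f b) (hi : i = 1 ∨ i = 2) (hu : u ∈ verts E)
    (hv : v ∈ verts E) (huv : place k i (b u) = place k i (b v))
    (hsingle : isSingle k (place k i (b u)) = true) : u = v := by
  have hb : b u = b v := by
    rcases lt_trichotomy (b u) (b v) with h' | h' | h'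
    · exact absurd (place_lt_place k i hi _ (h.block_lt v hv) _ h') (by omega)
    · exact h'
    · exact absurd (place_lt_place k i hi _ (h.block_lt u hu) _ h') (by omega)
  rcases eq_one_or_four_of_isSingle_place k i hi _ (h.block_lt u hu) hsingle with h' | h'
  · rw [(h.left u hu).1 h', (h.left v hv).1 (hb ▸ h')]
  · rw [(h.right u hu).1 h', (h.right v hv).1 (hb ▸ h')]

theorem IsBlockLayout.admissible_partShape {s t i : ℕ} {E : Finset (ℕ × ℕ)} {f b f' : ℕ → ℕ}
    (h : IsBlockLayout s t E f b) (c : ℕ × ℕ → ℕ × ℕ × ℕ)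
    (hc : ∀ e, (c e).1 = i → e ∈ E ∧ c e = (i, b e.1, b e.2))
    (hf : ∀ u ∈ verts E, ∀ v ∈ verts E, (f' u < f' v ↔ f u < f v))
    {l : List (ℕ × ℕ)} (hl : TwistList f' l) : admissible (partShape i (l.map c)) = true := by
  have hmem : ∀ e ∈ l.filter ((fun p : ℕ × ℕ × ℕ => p.1 == i) ∘ c), (c e).1 = i := fun e he => by
    simpa using (List.mem_filter.1 he).2
  have heq : partShape i (l.map c) = (l.filter ((fun p : ℕ × ℕ × ℕ => p.1 == i) ∘ c)).map
      fun e => 6 * b e.1 + b e.2 := by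
    rw [partShape, List.filter_map, List.map_map]
    refine List.map_congr_left fun e he => ?_
    simp [(hc e (hmem e he)).2]
  rw [heq]
  refine h.admissible_of_twist _ (fun e he => (hc e (hmem e he)).1) ?_
  refine (hl.sublist List.filter_sublist).imp_of_mem fun {e e'} he he' hee' => ?_
  have he := (hc e (hmem e he)).1
  have he' := (hc e' (hmem e' he')).1
  rwa [← hf _ (fst_mem_verts he) _ (fst_mem_verts he'),
    ← hf _ (snd_mem_verts he) _ (snd_mem_verts he'),
    ← hf _ (fst_mem_verts he') _ (snd_mem_verts he)]

theorem IsBlockLayout.merge {k : Bool} {s t x s₁ t₁ s₂ t₂ : ℕ} {E₁ E₂ : Finset (ℕ × ℕ)}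
    {f₁ b₁ f₂ b₂ : ℕ → ℕ} (h₁ : IsBlockLayout s₁ t₁ E₁ f₁ b₁) (h₂ : IsBlockLayout s₂ t₂ E₂ f₂ b₂)
    (hV : verts E₁ ∩ verts E₂ = {x})
    (hk : bif k then s₁ = s ∧ s₂ = t ∧ t₁ = x ∧ t₂ = x else t₁ = s ∧ t₂ = t ∧ s₁ = x ∧ s₂ = x) :
    ∃ f b, IsBlockLayout s t (insert (s, t) (E₁ ∪ E₂)) f b := by
  classical
  set E := insert (s, t) (E₁ ∪ E₂) with hE
  have hx : ∀ u, u ∈ verts E₁ → u ∈ verts E₂ → u = x := fun u h h' => by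
    simpa [hV] using Finset.mem_inter.2 ⟨h, h'⟩
  have hxV : x ∈ verts E₁ ∧ x ∈ verts E₂ := by
    rw [← Finset.mem_inter, hV]; simp
  have hs₁ : s ∈ verts E₁ := by
    cases k
    · exact hk.1 ▸ h₁.right_mem
    · exact hk.1 ▸ h₁.left_mem
  have ht₂ : t ∈ verts E₂ := by
    cases k
    · exact hk.2.1 ▸ h₂.right_mem
    · exact hk.2.1 ▸ h₂.left_mem
  have hvE : verts E = verts E₁ ∪ verts E₂ := by
    rw [hE, verts_insert, verts_union]
    ext u; simp only [Finset.mem_insert, Finset.mem_union]; grind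
  obtain ⟨N, hN⟩ : ∃ N, ∀ u ∈ verts E, f₁ u < N ∧ f₂ u < N := by
    refine ⟨(verts E).sup (fun u => f₁ u + f₂ u) + 1, fun u hu => ?_⟩
    have := Finset.le_sup (f := fun u => f₁ u + f₂ u) hu
    omega
  let g : ℕ → ℕ := fun u => if u ∈ verts E₁ then place k 1 (b₁ u) else place k 2 (b₂ u)
  let f : ℕ → ℕ := fun u => g u * N + if u ∈ verts E₁ then f₁ u else f₂ u
  have hbx₁ : b₁ x = bif k then 4 else 1 := by
    cases k
    · exact (h₁.left x hxV.1).2 hk.2.2.1.symm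
    · exact (h₁.right x hxV.1).2 hk.2.2.1.symm
  have hbx₂ : b₂ x = bif k then 4 else 1 := by
    cases k
    · exact (h₂.left x hxV.2).2 hk.2.2.2.symm
    · exact (h₂.right x hxV.2).2 hk.2.2.2.symm
  have hux₁ : ∀ u ∈ verts E₁, b₁ u = (bif k then 4 else 1) → u = x := fun u hu h => by
    cases k
    · exact ((h₁.left u hu).1 h).trans hk.2.2.1
    · exact ((h₁.right u hu).1 h).trans hk.2.2.1
  have hux₂ : ∀ u ∈ verts E₂, b₂ u = (bif k then 4 else 1) → u = x := fun u hu h => by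
    cases k
    · exact ((h₂.left u hu).1 h).trans hk.2.2.2
    · exact ((h₂.right u hu).1 h).trans hk.2.2.2
  have hg₁ : ∀ u ∈ verts E₁, g u = place k 1 (b₁ u) := fun u hu => if_pos hu
  have hg₂ : ∀ u ∈ verts E₂, g u = place k 2 (b₂ u) := fun u hu => by
    by_cases h : u ∈ verts E₁
    · obtain rfl := hx u h hu
      rw [hg₁ u h, hbx₁, hbx₂]
      cases k <;> rfl
    · exact if_neg h
  have hg_lt : ∀ u ∈ verts E, g u < 11 := fun u hu => by
    rcases Finset.mem_union.1 (hvE ▸ hu) with h | h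
    · rw [hg₁ u h]; exact place_lt k 1 (by omega) _ (h₁.block_lt u h)
    · rw [hg₂ u h]; exact place_lt k 2 (by omega) _ (h₂.block_lt u h)
  have hgs : g s = place k 0 1 := by
    rw [hg₁ s hs₁]
    cases k
    · rw [(h₁.right s hs₁).2 hk.1.symm]; rfl
    · rw [(h₁.left s hs₁).2 hk.1.symm]; rfl
  have hgt : g t = place k 0 4 := by
    rw [hg₂ t ht₂]
    cases k
    · rw [(h₂.right t ht₂).2 hk.2.1.symm]; rfl
    · rw [(h₂.left t ht₂).2 hk.2.1.symm]; rfl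
  have hf_of_g : ∀ u ∈ verts E, ∀ v ∈ verts E, g u < g v → f u < f v := fun u hu v hv h => by
    have h1 : (if u ∈ verts E₁ then f₁ u else f₂ u) < N := by
      split_ifs
      exacts [(hN u hu).1, (hN u hu).2]
    have h2 : (g u + 1) * N ≤ g v * N := Nat.mul_le_mul_right N h
    have h3 : (g u + 1) * N = g u * N + N := by ring
    simp only [f]
    omega
  have hg_of_f : ∀ u ∈ verts E, ∀ v ∈ verts E, f u < f v → g u ≤ g v := fun u hu v hv h => by
    by_contra hlt
    exact absurd (hf_of_g v hv u hu (by omega)) (by omega)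
  have hmono : ∀ (u v : ℕ) (b' f' : ℕ → ℕ) (i : ℕ), i = 1 ∨ i = 2 → b' u < 6 → b' v < 6 →
      (b' u < b' v → f' u < f' v) → (b' v < b' u → f' v < f' u) → u ∈ verts E → v ∈ verts E →
      g u = place k i (b' u) → g v = place k i (b' v) →
      (b' u = b' v → (f u < f v ↔ f' u < f' v)) → (f u < f v ↔ f' u < f' v) := by
    intro u v b' f' i hi hu hv h h' hu' hv' hgu hgv heq
    rcases lt_trichotomy (b' u) (b' v) with hlt | hlt | hlt
    · have := hf_of_g u hu' v hv' (by rw [hgu, hgv]; exact place_lt_place k i hi _ hv _ hlt)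
      simp [this, h hlt]
    · exact heq hlt
    · have := hf_of_g v hv' u hu' (by rw [hgu, hgv]; exact place_lt_place k i hi _ hu _ hlt)
      have := h' hlt
      omega
  have hsub₁ : ∀ u ∈ verts E₁, u ∈ verts E := fun u hu => hvE ▸ Finset.mem_union_left _ hu
  have hsub₂ : ∀ u ∈ verts E₂, u ∈ verts E := fun u hu => hvE ▸ Finset.mem_union_right _ hu
  have hf₁ : ∀ u ∈ verts E₁, ∀ v ∈ verts E₁, (f u < f v ↔ f₁ u < f₁ v) := fun u hu v hv => by
    refine hmono u v b₁ f₁ 1 (Or.inl rfl) (h₁.block_lt u hu) (h₁.block_lt v hv)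
      (h₁.lt_of_block_lt u hu v hv) (h₁.lt_of_block_lt v hv u hu) (hsub₁ u hu) (hsub₁ v hv)
      (hg₁ u hu) (hg₁ v hv) fun heq => ?_
    simp only [f, hg₁ u hu, hg₁ v hv, heq, if_pos hu, if_pos hv]
    omega
  have hf₂ : ∀ u ∈ verts E₂, ∀ v ∈ verts E₂, (f u < f v ↔ f₂ u < f₂ v) := fun u hu v hv => by
    refine hmono u v b₂ f₂ 2 (Or.inr rfl) (h₂.block_lt u hu) (h₂.block_lt v hv)
      (h₂.lt_of_block_lt u hu v hv) (h₂.lt_of_block_lt v hv u hu) (hsub₂ u hu) (hsub₂ v hv)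
      (hg₂ u hu) (hg₂ v hv) fun heq => ?_
    by_cases hu₁ : u ∈ verts E₁
    · obtain rfl := hx u hu₁ hu
      obtain rfl := hux₂ v hv (heq ▸ hbx₂)
      simp
    by_cases hv₁ : v ∈ verts E₁
    · obtain rfl := hx v hv₁ hv
      obtain rfl := hux₂ u hu (heq ▸ hbx₂)
      simp
    simp only [f, hg₂ u hu, hg₂ v hv, heq, if_neg hu₁, if_neg hv₁]
    omega
  have hsame : ∀ u ∈ verts E, ∀ v ∈ verts E, g u = g v →
      (u ∈ verts E₁ ∧ v ∈ verts E₁) ∨ (u ∈ verts E₂ ∧ v ∈ verts E₂) := by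
    have aux : ∀ u ∈ verts E₁, ∀ v ∈ verts E₂, g u = g v → u = v := fun u hu v hv h => by
      rw [hg₁ u hu, hg₂ v hv] at h
      obtain ⟨hu', hv'⟩ := eq_of_place_eq k _ (h₁.block_lt u hu) _ (h₂.block_lt v hv) h
      rw [hux₁ u hu hu', hux₂ v hv hv']
    intro u hu v hv h
    rcases Finset.mem_union.1 (hvE ▸ hu) with hu | hu <;>
      rcases Finset.mem_union.1 (hvE ▸ hv) with hv | hv
    · exact Or.inl ⟨hu, hv⟩
    · exact Or.inl ⟨hu, aux u hu v hv h ▸ hu⟩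
    · exact Or.inl ⟨aux v hv u hu h.symm ▸ hv, hv⟩
    · exact Or.inr ⟨hu, hv⟩
  have hinj : ∀ u ∈ verts E, ∀ v ∈ verts E, f u = f v → u = v := fun u hu v hv h => by
    have hg : g u = g v := by
      rcases lt_trichotomy (g u) (g v) with h' | h' | h'
      · exact absurd (hf_of_g u hu v hv h') (by omega)
      · exact h'
      · exact absurd (hf_of_g v hv u hu h') (by omega)
    rcases hsame u hu v hv hg with ⟨hu, hv⟩ | ⟨hu, hv⟩
    · refine h₁.inj u hu v hv ?_
      have := hf₁ u hu v hv
      have := hf₁ v hv u hu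
      omega
    · refine h₂.inj u hu v hv ?_
      have := hf₂ u hu v hv
      have := hf₂ v hv u hu
      omega
  have hsingle : ∀ u ∈ verts E, ∀ v ∈ verts E, g u = g v → isSingle k (g u) = true → u = v := by
    intro u hu v hv hg hsg
    rcases hsame u hu v hv hg with ⟨hu, hv⟩ | ⟨hu, hv⟩
    · rw [hg₁ u hu, hg₁ v hv] at hg
      exact h₁.eq_of_isSingle_place (Or.inl rfl) hu hv hg (hg₁ u hu ▸ hsg)
    · rw [hg₂ u hu, hg₂ v hv] at hg
      exact h₂.eq_of_isSingle_place (Or.inr rfl) hu hv hg (hg₂ u hu ▸ hsg)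
  have hprec : ∀ u ∈ verts E, ∀ v ∈ verts E, f u < f v → precedes k (g u) (g v) = true := by
    intro u hu v hv h
    simp only [precedes, Bool.or_eq_true, Bool.and_eq_true, beq_iff_eq, Bool.not_eq_true',
      Nat.blt_eq]
    rcases (hg_of_f u hu v hv h).lt_or_eq with h' | h'
    · exact Or.inl h'
    · refine Or.inr ⟨h', ?_⟩
      by_contra hsg
      rw [hsingle u hu v hv h' (by simpa using hsg)] at h
      omega
  let c : ℕ × ℕ → ℕ × ℕ × ℕ := fun e => if e ∈ E₁ then (1, b₁ e.1, b₁ e.2)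
    else if e ∈ E₂ then (2, b₂ e.1, b₂ e.2) else (0, 1, 4)
  have hc : ∀ e ∈ E, g e.1 = place k (c e).1 (c e).2.1 ∧ g e.2 = place k (c e).1 (c e).2.2 := by
    intro e he
    simp only [c]
    split_ifs with he₁ he₂
    · exact ⟨hg₁ _ (fst_mem_verts he₁), hg₁ _ (snd_mem_verts he₁)⟩
    · exact ⟨hg₂ _ (fst_mem_verts he₂), hg₂ _ (snd_mem_verts he₂)⟩
    · obtain rfl : e = (s, t) := by
        simpa [hE, he₁, he₂] using he
      exact ⟨hgs, hgt⟩
  have htw₁ : ∀ l : List (ℕ × ℕ), TwistList f l → admissible (partShape 1 (l.map c)) = true :=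
    fun l hl => h₁.admissible_partShape c (fun e he => by grind) hf₁ hl
  have htw₂ : ∀ l : List (ℕ × ℕ), TwistList f l → admissible (partShape 2 (l.map c)) = true :=
    fun l hl => h₂.admissible_partShape c (fun e he => by grind) hf₂ hl
  have hctypes : ∀ e ∈ E, c e ∈ edgeTypes := by
    intro e he
    simp only [c]
    split_ifs with he₁ he₂
    · exact mem_edgeTypes (Or.inl rfl) (h₁.block_lt _ (fst_mem_verts he₁))
        (h₁.block_lt _ (snd_mem_verts he₁))
        (h₁.admissible_of_twist [e] (by simpa using he₁) (List.pairwise_singleton _ _))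
    · exact mem_edgeTypes (Or.inr rfl) (h₂.block_lt _ (fst_mem_verts he₂))
        (h₂.block_lt _ (snd_mem_verts he₂))
        (h₂.admissible_of_twist [e] (by simpa using he₂) (List.pairwise_singleton _ _))
    · exact List.mem_cons_self
  refine ⟨f, fun u => mergeBlock k (g u), ?_, hinj, fun u hu => mergeBlock_lt k _ (hg_lt u hu),
    fun u hu v hv h => hf_of_g u hu v hv (lt_of_mergeBlock_lt k _ (hg_lt u hu) _ (hg_lt v hv) h),
    hsub₁ s hs₁, hsub₂ t ht₂, fun u hu => ?_, fun u hu => ?_, fun l hl ht => ?_⟩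
  · intro e he
    rcases Finset.mem_insert.1 he with rfl | he
    · refine hf_of_g _ (hsub₁ s hs₁) _ (hsub₂ t ht₂) ?_
      rw [hgs, hgt]
      cases k <;> decide
    · rcases Finset.mem_union.1 he with he | he
      · exact (hf₁ _ (fst_mem_verts he) _ (snd_mem_verts he)).2 (h₁.lt_of_mem e he)
      · exact (hf₂ _ (fst_mem_verts he) _ (snd_mem_verts he)).2 (h₂.lt_of_mem e he)
  · rw [mergeBlock_eq_one k _ (hg_lt u hu), ← hgs]
    refine ⟨fun h => (hsingle s (hsub₁ s hs₁) u hu h.symm ?_).symm, fun h => h ▸ rfl⟩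
    rw [hgs]; cases k <;> decide
  · rw [mergeBlock_eq_four k _ (hg_lt u hu), ← hgt]
    refine ⟨fun h => (hsingle t (hsub₂ t ht₂) u hu h.symm ?_).symm, fun h => h ▸ rfl⟩
    rw [hgt]; cases k <;> decide
  · have := admissible_of_closed k (fun l => (∀ e ∈ l, e ∈ E) ∧ TwistList f l) c
      (fun e l h => ⟨fun e' he' => h.1 e' (List.mem_cons_of_mem _ he'), h.2.of_cons⟩)
      (fun e l h => ?_) l ⟨hl, ht⟩
    · rw [mergedShape, List.map_map] at this
      rw [← this]
      congr 1
      refine List.map_congr_left fun e he => ?_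
      simp only [Function.comp, (hc e (hl e he)).1, (hc e (hl e he)).2]
    · have he := h.1 e List.mem_cons_self
      refine ⟨hctypes e he, ?_⟩
      simp only [canExtend, Bool.and_eq_true, List.all_eq_true, List.forall_mem_map]
      refine ⟨fun e' he' => ?_, htw₁ (e :: l) h.2, htw₂ (e :: l) h.2⟩
      obtain ⟨h1, h2, h3⟩ := (List.pairwise_cons.1 h.2).1 e' he'
      have he'E := h.1 e' (List.mem_cons_of_mem _ he')
      simp only [compatible, Bool.and_eq_true, ← (hc e he).1, ← (hc e he).2, ← (hc e' he'E).1,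
        ← (hc e' he'E).2]
      exact ⟨⟨hprec _ (fst_mem_verts he) _ (fst_mem_verts he'E) h1,
        hprec _ (snd_mem_verts he) _ (snd_mem_verts he'E) h2⟩,
        hprec _ (fst_mem_verts he'E) _ (snd_mem_verts he) h3⟩

/-- `E` is a monotone outerplanar DAG with base edge `(s, t)` and outer edges `A`, described by
splitting it at the vertex stellating the base edge. -/
inductive IsDecomposed : ℕ → ℕ → Finset (ℕ × ℕ) → Finset (ℕ × ℕ) → Prop
  | edge (s t : ℕ) (h : s ≠ t) : IsDecomposed s t {(s, t)} {(s, t)}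
  | sink (s t x : ℕ) (E₁ A₁ E₂ A₂ : Finset (ℕ × ℕ)) (h₁ : IsDecomposed s x E₁ A₁)
      (h₂ : IsDecomposed t x E₂ A₂) (hV : verts E₁ ∩ verts E₂ = {x}) :
      IsDecomposed s t (insert (s, t) (E₁ ∪ E₂)) (A₁ ∪ A₂)
  | source (s t x : ℕ) (E₁ A₁ E₂ A₂ : Finset (ℕ × ℕ)) (h₁ : IsDecomposed x s E₁ A₁)
      (h₂ : IsDecomposed x t E₂ A₂) (hV : verts E₁ ∩ verts E₂ = {x}) :
      IsDecomposed s t (insert (s, t) (E₁ ∪ E₂)) (A₁ ∪ A₂)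

theorem IsDecomposed.exists_isBlockLayout {s t : ℕ} {E A : Finset (ℕ × ℕ)}
    (h : IsDecomposed s t E A) : ∃ f b, IsBlockLayout s t E f b := by
  induction h with
  | edge s t h => exact ⟨_, _, isBlockLayout_singleton h⟩
  | sink s t x E₁ A₁ E₂ A₂ _ _ hV ih₁ ih₂ =>
    obtain ⟨f₁, b₁, h₁⟩ := ih₁
    obtain ⟨f₂, b₂, h₂⟩ := ih₂
    exact h₁.merge (k := true) h₂ hV ⟨rfl, rfl, rfl, rfl⟩
  | source s t x E₁ A₁ E₂ A₂ _ _ hV ih₁ ih₂ =>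
    obtain ⟨f₁, b₁, h₁⟩ := ih₁
    obtain ⟨f₂, b₂, h₂⟩ := ih₂
    exact h₁.merge (k := false) h₂ hV ⟨rfl, rfl, rfl, rfl⟩

theorem IsDecomposed.subset {s t : ℕ} {E A : Finset (ℕ × ℕ)} (h : IsDecomposed s t E A) :
    A ⊆ E := by
  induction h with
  | edge s t h => exact subset_rfl
  | sink s t x E₁ A₁ E₂ A₂ _ _ hV ih₁ ih₂ =>
    exact (Finset.union_subset_union ih₁ ih₂).trans (Finset.subset_insert _ _)
  | source s t x E₁ A₁ E₂ A₂ _ _ hV ih₁ ih₂ =>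
    exact (Finset.union_subset_union ih₁ ih₂).trans (Finset.subset_insert _ _)

theorem IsDecomposed.ne {s t : ℕ} {E A : Finset (ℕ × ℕ)} (h : IsDecomposed s t E A) :
    ∀ e ∈ E, e.1 ≠ e.2 := by
  obtain ⟨f, b, hf⟩ := h.exists_isBlockLayout
  intro e he heq
  exact absurd (hf.lt_of_mem e he) (by simp [heq])

theorem not_mem_right_of_verts_inter {x : ℕ} {E₁ E₂ : Finset (ℕ × ℕ)} {e : ℕ × ℕ}
    (hV : verts E₁ ∩ verts E₂ = {x}) (he : e.1 ≠ e.2) (h₁ : e ∈ E₁) : e ∉ E₂ := by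
  intro h₂
  have h := Finset.mem_inter.2 ⟨fst_mem_verts h₁, fst_mem_verts h₂⟩
  have h' := Finset.mem_inter.2 ⟨snd_mem_verts h₁, snd_mem_verts h₂⟩
  rw [hV, Finset.mem_singleton] at h h'
  exact he (h.trans h'.symm)

theorem insert_insert_erase_union {α : Type*} [DecidableEq α] {A B : Finset α} {a b e : α}
    (he : e ∉ B) :
    insert a (insert b ((A ∪ B).erase e)) = insert a (insert b (A.erase e)) ∪ B := by
  ext y
  simp only [Finset.mem_insert, Finset.mem_union, Finset.mem_erase]
  grind

theorem insert_insert_insert_union {α : Type*} [DecidableEq α] {E F : Finset α} {a b e : α} :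
    insert a (insert b (insert e (E ∪ F))) = insert e (insert a (insert b E) ∪ F) := by
  ext y
  simp only [Finset.mem_insert, Finset.mem_union]
  tauto

theorem verts_stellate {E : Finset (ℕ × ℕ)} {u v x : ℕ} {e e' : ℕ × ℕ} (huv : (u, v) ∈ E)
    (he : e = (u, x) ∧ e' = (v, x) ∨ e = (x, u) ∧ e' = (x, v)) :
    verts (insert e (insert e' E)) = insert x (verts E) := by
  have hu := fst_mem_verts huv
  have hv := snd_mem_verts huv
  ext y
  rcases he with ⟨rfl, rfl⟩ | ⟨rfl, rfl⟩ <;> simp only [verts_insert, Finset.mem_insert] <;> grind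

/-- Stellating an outer edge of the first part preserves a split along `x`. -/
theorem verts_stellate_inter {E₁ E₂ : Finset (ℕ × ℕ)} {u v x y : ℕ} {e e' : ℕ × ℕ}
    (hV : verts E₁ ∩ verts E₂ = {x}) (huv : (u, v) ∈ E₁) (hy : y ∉ verts E₂)
    (he : e = (u, y) ∧ e' = (v, y) ∨ e = (y, u) ∧ e' = (y, v)) :
    verts (insert e (insert e' E₁)) ∩ verts E₂ = {x} := by
  rw [verts_stellate huv he, Finset.insert_inter_of_notMem hy, hV]

theorem IsDecomposed.stellate {s t : ℕ} {E A : Finset (ℕ × ℕ)} (h : IsDecomposed s t E A)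
    {u v x : ℕ} {e e' : ℕ × ℕ} (huv : (u, v) ∈ A) (hx : x ∉ verts E)
    (he : e = (u, x) ∧ e' = (v, x) ∨ e = (x, u) ∧ e' = (x, v)) :
    IsDecomposed s t (insert e (insert e' E)) (insert e (insert e' (A.erase (u, v)))) := by
  induction h with
  | edge s t h =>
    simp only [Finset.mem_singleton, Prod.mk.injEq] at huv
    obtain ⟨rfl, rfl⟩ := huv
    simp only [verts_singleton, Finset.mem_insert, Finset.mem_singleton, not_or] at hx
    have hE : insert e (insert e' {(u, v)}) = insert (u, v) ({e} ∪ ({e'} : Finset (ℕ × ℕ))) := by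
      ext y; simp only [Finset.mem_insert, Finset.mem_union, Finset.mem_singleton]; tauto
    have hA : insert e (insert e' (({(u, v)} : Finset (ℕ × ℕ)).erase (u, v))) = {e} ∪ {e'} := by
      ext y; simp
    rw [hE, hA]
    rcases he with ⟨rfl, rfl⟩ | ⟨rfl, rfl⟩
    · refine .sink u v x _ _ _ _ (.edge _ _ (Ne.symm hx.1)) (.edge _ _ (Ne.symm hx.2)) ?_
      ext y; simp only [verts_singleton, Finset.mem_inter, Finset.mem_insert,
        Finset.mem_singleton]; grind
    · refine .source u v x _ _ _ _ (.edge _ _ hx.1) (.edge _ _ hx.2) ?_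
      ext y; simp only [verts_singleton, Finset.mem_inter, Finset.mem_insert,
        Finset.mem_singleton]; grind
  | sink s t y E₁ A₁ E₂ A₂ h₁ h₂ hV ih₁ ih₂ =>
    simp only [verts_insert, verts_union, Finset.mem_insert, Finset.mem_union, not_or] at hx
    obtain ⟨-, -, hx₁, hx₂⟩ := hx
    by_cases huv₁ : (u, v) ∈ A₁
    · have hE := h₁.subset huv₁
      have hn := not_mem_right_of_verts_inter hV (h₁.ne _ hE) hE
      rw [insert_insert_insert_union, insert_insert_erase_union fun h => hn (h₂.subset h)]
      exact .sink _ _ _ _ _ _ _ (ih₁ huv₁ hx₁) h₂ (verts_stellate_inter hV hE hx₂ he)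
    · have huv₂ := (Finset.mem_union.1 huv).resolve_left huv₁
      rw [Finset.union_comm E₁, Finset.union_comm A₁, insert_insert_insert_union,
        insert_insert_erase_union huv₁, Finset.union_comm _ E₁, Finset.union_comm _ A₁]
      refine .sink _ _ _ _ _ _ _ h₁ (ih₂ huv₂ hx₂) ?_
      rw [Finset.inter_comm] at hV ⊢
      exact verts_stellate_inter hV (h₂.subset huv₂) hx₁ he
  | source s t y E₁ A₁ E₂ A₂ h₁ h₂ hV ih₁ ih₂ =>
    simp only [verts_insert, verts_union, Finset.mem_insert, Finset.mem_union, not_or] at hx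
    obtain ⟨-, -, hx₁, hx₂⟩ := hx
    by_cases huv₁ : (u, v) ∈ A₁
    · have hE := h₁.subset huv₁
      have hn := not_mem_right_of_verts_inter hV (h₁.ne _ hE) hE
      rw [insert_insert_insert_union, insert_insert_erase_union fun h => hn (h₂.subset h)]
      exact .source _ _ _ _ _ _ _ (ih₁ huv₁ hx₁) h₂ (verts_stellate_inter hV hE hx₂ he)
    · have huv₂ := (Finset.mem_union.1 huv).resolve_left huv₁
      rw [Finset.union_comm E₁, Finset.union_comm A₁, insert_insert_insert_union,
        insert_insert_erase_union huv₁, Finset.union_comm _ E₁, Finset.union_comm _ A₁]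
      refine .source _ _ _ _ _ _ _ h₁ (ih₂ huv₂ hx₂) ?_
      rw [Finset.inter_comm] at hV ⊢
      exact verts_stellate_inter hV (h₂.subset huv₂) hx₁ he

theorem MonBuild.exists_isDecomposed {E A : Finset (ℕ × ℕ)} (h : MonBuild E A) :
    ∃ s t, IsDecomposed s t E A := by
  induction h with
  | base s t h => exact ⟨s, t, .edge s t h⟩
  | monoSink E A u v x _ hA hx ih =>
    obtain ⟨s, t, h⟩ := ih
    exact ⟨s, t, h.stellate hA hx (Or.inl ⟨rfl, rfl⟩)⟩
  | monoSource E A u v x _ hA hx ih =>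
    obtain ⟨s, t, h⟩ := ih
    exact ⟨s, t, h.stellate hA hx (Or.inr ⟨rfl, rfl⟩)⟩

/-- Every monotone outerplanar DAG admits a linear extension whose maximum
twist size is at most 4. -/
theorem monotone_odag_twist_le_four (E : Finset (ℕ × ℕ))
    (hE : IsMonotoneODAG E) :
    ∃ f, LinExt E f ∧ TwistLE E f 4 := by
  obtain ⟨A, hA⟩ := hE
  obtain ⟨s, t, hst⟩ := hA.exists_isDecomposed
  obtain ⟨f, b, h⟩ := hst.exists_isBlockLayout
  let f' : ℕ → ℕ := fun v => if v ∈ verts E then 2 * f v else 2 * v + 1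
  have hf' : ∀ u ∈ verts E, f' u = 2 * f u := fun u hu => if_pos hu
  refine ⟨f', ⟨fun u v huv => ?_, fun e he => ?_⟩, fun m S T hST => ?_⟩
  · simp only [f'] at huv
    split_ifs at huv with hu hv hv
    · exact h.inj u hu v hv (by omega)
    all_goals omega
  · rw [hf' _ (fst_mem_verts he), hf' _ (snd_mem_verts he)]
    have := h.lt_of_mem e he
    omega
  · obtain ⟨hmem, hS, hT, hlt⟩ := hST
    have hfS : ∀ i, f' (S i) = 2 * f (S i) := fun i => hf' _ (fst_mem_verts (hmem i))
    have hfT : ∀ i, f' (T i) = 2 * f (T i) := fun i => hf' _ (snd_mem_verts (hmem i))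
    have hl : TwistList f (List.ofFn fun i => (S i, T i)) := by
      refine List.pairwise_ofFn.2 fun i j hij => ?_
      have h1 := hS hij
      have h2 := hT hij
      have h3 := hlt j i
      simp only [Function.comp, hfS, hfT] at h1 h2 h3
      exact ⟨show f (S i) < f (S j) by omega, show f (T i) < f (T j) by omega,
        show f (S j) < f (T i) by omega⟩
    have hadm := h.admissible_of_twist _ (fun e he => by
      obtain ⟨i, rfl⟩ := List.mem_ofFn.1 he
      exact hmem i) hl
    simpa using length_le_four_of_admissible hadm
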